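/- For every m ≥ 2 and n = 2m + 2 there exists α < α*_m := m(m−1)^{(1−m)/m} such that, setting Q_α(ξ′, ξ_n) := |ξ′|^{2m} − α|ξ′|^{2m−2}ξ_n² + ξ_n^{2m} and G_α(y) := ∫_{{ξ ∈ S^{n−1} : ⟨y,ξ⟩ > 0}} log(⟨y,ξ⟩)/Q_α(ξ) dH^{n−1}(ξ), one has ΔG_α(e_n) < 0, where e_n = (0,…,0,1). -/

import Mathlib

open MeasureTheory RealInnerProductSpace

noncomputable section

/-- ℝⁿ as a Euclidean space. -/
abbrev En (n : ℕ) : Type := EuclideanSpace ℝ (Fin n)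

/-- The `i`-th standard basis vector of ℝⁿ. -/
def stdB (n : ℕ) (i : Fin n) : En n := EuclideanSpace.single i 1

/-- The symbol Q(ξ) = Σ_{i₁,…,i_{2m}} A_{i₁…i_{2m}} ξ_{i₁}⋯ξ_{i_{2m}}. -/
def symbolQ (n m : ℕ) (A : (Fin (2*m) → Fin n) → ℝ) (ξ : En n) : ℝ :=
  ∑ i : Fin (2*m) → Fin n, A i * ∏ j, ξ (i j)

/-- The constant-coefficient operator
(Lψ)(x) = (−1)^m Σ A_{i₁…i_{2m}} ∂_{i₁}⋯∂_{i_{2m}} ψ(x). -/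
def opL (n m : ℕ) (A : (Fin (2*m) → Fin n) → ℝ) (ψ : En n → ℝ) (x : En n) : ℝ :=
  (-1 : ℝ)^m * ∑ i : Fin (2*m) → Fin n,
    A i * iteratedFDeriv ℝ (2*m) ψ x (fun j => stdB n (i j))

/-- K is a fundamental solution of L: ∫ K(y) (Lψ)(y) dy = ψ(0) for all ψ ∈ C_c^∞. -/
def IsFundamentalSolution (n m : ℕ) (A : (Fin (2*m) → Fin n) → ℝ) (K : En n → ℝ) : Prop :=
  ∀ ψ : En n → ℝ, ContDiff ℝ (⊤ : ℕ∞) ψ → HasCompactSupport ψ →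
    ∫ y, K y * opL n m A ψ y = ψ 0

/-- K is homogeneous of degree a: K(σx) = |σ|^a K(x) for σ ≠ 0, x ≠ 0. -/
def HomogeneousDeg (n : ℕ) (a : ℝ) (K : En n → ℝ) : Prop :=
  ∀ σ : ℝ, σ ≠ 0 → ∀ x : En n, x ≠ 0 → K (σ • x) = |σ| ^ a * K x

/-- The Euclidean Laplacian Δf(x) = Σ_i ∂²f/∂x_i²(x). -/
def lap (n : ℕ) (f : En n → ℝ) (x : En n) : ℝ :=
  ∑ i : Fin n, iteratedFDeriv ℝ 2 f x (fun _ => stdB n i)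

/-- The point (x′, t) ∈ ℝ^{d} × ℝ = ℝ^{d+1}. -/
def snocVec (d : ℕ) (x' : En d) (t : ℝ) : En (d+1) :=
  (EuclideanSpace.equiv (Fin (d+1)) ℝ).symm (Fin.snoc (fun i => x' i) t)

/-- |ξ′|², the squared norm of the first d coordinates of ξ ∈ ℝ^{d+1}. -/
def normSq' (d : ℕ) (ξ : En (d+1)) : ℝ := ∑ i : Fin d, (ξ i.castSucc)^2

/-- Q_α(ξ′, ξ_n) = |ξ′|^{2m} − α|ξ′|^{2m−2}ξ_n² + ξ_n^{2m}. -/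
def Qalpha (d m : ℕ) (α : ℝ) (ξ : En (d+1)) : ℝ :=
  (normSq' d ξ)^m - α * (normSq' d ξ)^(m-1) * (ξ (Fin.last d))^2 + (ξ (Fin.last d))^(2*m)

/-- G_α(y) = ∫_{{ξ ∈ S^{n−1} : ⟨y,ξ⟩ > 0}} log(⟨y,ξ⟩)/Q_α(ξ) dH^{n−1}(ξ),
in dimension n = 2m+2 = (2m+1)+1. -/
def Galpha (m : ℕ) (α : ℝ) (y : En (2*m+1+1)) : ℝ :=
  ∫ ξ in {ξ : En (2*m+1+1) | ‖ξ‖ = 1 ∧ 0 < ⟪y, ξ⟫},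
    Real.log (⟪y, ξ⟫) / Qalpha (2*m+1) m α ξ ∂μH[((2*m+1+1 : ℕ) : ℝ) - 1]


section

def sig (d : ℕ) : Measure (En (d+1)) := (μH[(d:ℝ)]).restrict (Metric.sphere 0 1)

/-- the chart onto a face of the cube -/
def faceMap (d : ℕ) (i : Fin (d+1)) (ε : ℝ) (x : Fin d → ℝ) : En (d+1) :=
  WithLp.toLp 2 (Fin.insertNth i ε x)

lemma faceMap_contDiff (d : ℕ) (i : Fin (d+1)) (ε : ℝ) : ContDiff ℝ 1 (faceMap d i ε) := by
  rw [contDiff_euclidean]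
  intro j
  unfold faceMap
  refine Fin.succAboveCases i ?_ ?_ j
  · simpa using contDiff_const
  · intro k
    simpa using contDiff_apply ℝ ℝ k

lemma faceMap_ne (d : ℕ) (i : Fin (d+1)) (ε : ℝ) (hε : ε ≠ 0) (x : Fin d → ℝ) :
    faceMap d i ε x ≠ 0 := by
  intro h
  have : faceMap d i ε x i = 0 := by rw [h]; rfl
  simp [faceMap] at this
  exact hε this

def faceN (d : ℕ) (i : Fin (d+1)) (ε : ℝ) (x : Fin d → ℝ) : En (d+1) :=
  ‖faceMap d i ε x‖⁻¹ • faceMap d i ε x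

lemma faceN_contDiff (d : ℕ) (i : Fin (d+1)) (ε : ℝ) (hε : ε ≠ 0) :
    ContDiff ℝ 1 (faceN d i ε) := by
  unfold faceN
  refine ContDiff.smul (ContDiff.inv (ContDiff.norm ℝ (faceMap_contDiff d i ε) ?_) ?_)
    (faceMap_contDiff d i ε)
  · exact faceMap_ne d i ε hε
  · intro x; exact norm_ne_zero_iff.2 (faceMap_ne d i ε hε x)

lemma face_finite (d : ℕ) (i : Fin (d+1)) (ε : ℝ) (hε : ε ≠ 0) :
    μH[(d:ℝ)] (faceN d i ε '' (Set.Icc (fun _ => -1) (fun _ => 1))) < ⊤ := by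
  have hc : IsCompact (Set.Icc (fun _ => -1 : Fin d → ℝ) (fun _ => 1)) := isCompact_Icc
  obtain ⟨K, hK⟩ := LocallyLipschitzOn.exists_lipschitzOnWith_of_compact hc
    ((faceN_contDiff d i ε hε).locallyLipschitz.locallyLipschitzOn)
  refine lt_of_le_of_lt (hK.hausdorffMeasure_image_le (Nat.cast_nonneg d)) ?_
  have h := hausdorffMeasure_pi_real (ι := Fin d)
  rw [Fintype.card_fin] at h
  rw [h]
  refine ENNReal.mul_lt_top ?_ hc.measure_lt_top
  exact ENNReal.rpow_lt_top_of_nonneg (Nat.cast_nonneg d) ENNReal.coe_ne_top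

lemma sphere_cover (d : ℕ) : Metric.sphere (0 : En (d+1)) 1 ⊆
    ⋃ i : Fin (d+1), (faceN d i 1 '' (Set.Icc (fun _ => -1) (fun _ => 1))) ∪
      (faceN d i (-1) '' (Set.Icc (fun _ => -1) (fun _ => 1))) := by
  intro ξ hξ
  rw [mem_sphere_zero_iff_norm] at hξ
  obtain ⟨i, -, hi⟩ := Finset.exists_max_image Finset.univ (fun i => |ξ i|) Finset.univ_nonempty
  have hpos : 0 < |ξ i| := by
    rcases (abs_nonneg (ξ i)).lt_or_eq with h | h
    · exact h
    · exfalso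
      have : ξ = 0 := by
        ext j
        have := hi j (Finset.mem_univ j)
        rw [← h] at this
        simpa using this
      rw [this] at hξ; simp at hξ
  have key : ∀ ε : ℝ, ε * |ξ i| = ξ i → ξ ∈ (faceN d i ε '' (Set.Icc (fun _ => -1) (fun _ => 1))) := by
    intro ε hε
    refine ⟨fun k => ξ (i.succAbove k) / |ξ i|, ?_, ?_⟩
    · constructor
      · intro k
        show -1 ≤ ξ (i.succAbove k) / |ξ i|
        rw [le_div_iff₀ hpos]
        have := hi (i.succAbove k) (Finset.mem_univ _)
        have := neg_abs_le (ξ (i.succAbove k))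
        simp only at *
        linarith
      · intro k
        show ξ (i.succAbove k) / |ξ i| ≤ 1
        rw [div_le_iff₀ hpos]
        have := hi (i.succAbove k) (Finset.mem_univ _)
        have := le_abs_self (ξ (i.succAbove k))
        simp only at *
        linarith
    · have h1 : faceMap d i ε (fun k => ξ (i.succAbove k) / |ξ i|) = |ξ i|⁻¹ • ξ := by
        ext j
        unfold faceMap
        refine Fin.succAboveCases i ?_ ?_ j
        · simp
          field_simp
          linarith
        · intro k
          simp [div_eq_inv_mul]
      unfold faceN
      rw [h1, norm_smul, hξ, smul_smul]
      simp
      rw [mul_inv_cancel₀ hpos.ne', one_smul]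
  rw [Set.mem_iUnion]
  refine ⟨i, ?_⟩
  rcases le_total 0 (ξ i) with h | h
  · left; apply key; rw [abs_of_nonneg h]; ring
  · right; apply key; rw [abs_of_nonpos h]; ring

instance sig_finite (d : ℕ) : IsFiniteMeasure (sig d) := by
  constructor
  unfold sig
  rw [Measure.restrict_apply_univ]
  refine lt_of_le_of_lt (measure_mono (sphere_cover d)) ?_
  refine lt_of_le_of_lt (measure_iUnion_fintype_le _ _) ?_
  rw [ENNReal.sum_lt_top]
  intro i _
  refine lt_of_le_of_lt (measure_union_le _ _) ?_
  rw [ENNReal.add_lt_top]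
  exact ⟨face_finite d i 1 one_ne_zero, face_finite d i (-1) (by norm_num)⟩

lemma sig_ne_zero (d : ℕ) : sig d Set.univ ≠ 0 := by
  unfold sig
  rw [Measure.restrict_apply_univ]
  intro h0
  let p : En (d+1) → (Fin d → ℝ) := fun ξ k => ξ k.castSucc
  have hp : LipschitzWith 1 p := by
    refine LipschitzWith.of_dist_le_mul ?_
    intro x y
    rw [NNReal.coe_one, one_mul, dist_pi_le_iff dist_nonneg]
    intro k
    rw [Real.dist_eq, dist_eq_norm]
    have := PiLp.norm_apply_le (x - y) k.castSucc
    simpa [p] using this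
  have h1 := hp.hausdorffMeasure_image_le (Nat.cast_nonneg d) (Metric.sphere (0 : En (d+1)) 1)
  rw [h0, mul_zero] at h1
  have h := hausdorffMeasure_pi_real (ι := Fin d)
  rw [Fintype.card_fin] at h
  rw [h] at h1
  let U : Set (Fin d → ℝ) := {x | ∑ k, x k ^ 2 < 1}
  have hU : IsOpen U := isOpen_lt (by fun_prop) continuous_const
  have hUn : U.Nonempty := ⟨0, by simp [U]⟩
  have hsub : U ⊆ p '' (Metric.sphere (0 : En (d+1)) 1) := by
    intro x hx
    refine ⟨WithLp.toLp 2 (Fin.snoc x (Real.sqrt (1 - ∑ k, x k ^ 2))), ?_, ?_⟩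
    · rw [mem_sphere_zero_iff_norm, EuclideanSpace.norm_eq, Fin.sum_univ_castSucc]
      have : 0 ≤ 1 - ∑ k, x k ^ 2 := by
        have : ∑ k, x k ^ 2 < 1 := hx
        linarith
      simp [Real.sq_sqrt this]
    · ext k; simp [p]
  have := hU.measure_pos volume hUn
  exact absurd (le_trans (measure_mono hsub) h1) (not_le.2 this)

lemma sig_mp (d : ℕ) (T : En (d+1) ≃ₗᵢ[ℝ] En (d+1)) : MeasurePreserving T (sig d) (sig d) := by
  have h := (T.toIsometryEquiv.measurePreserving_hausdorffMeasure (d:ℝ)).restrict_preimage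
    (s := Metric.sphere 0 1) Metric.isClosed_sphere.measurableSet
  have h2 : (T.toIsometryEquiv ⁻¹' Metric.sphere 0 1) = Metric.sphere 0 1 := by
    ext x; simp
  rw [h2] at h
  exact h

lemma sig_ae (d : ℕ) : ∀ᵐ ξ ∂(sig d), ‖ξ‖ = 1 := by
  unfold sig
  filter_upwards [ae_restrict_mem Metric.isClosed_sphere.measurableSet] with ξ hξ
  simpa using hξ

end


section

section paramint
set_option linter.unusedSectionVars false
variable {E : Type} [NormedAddCommGroup E] [InnerProductSpace ℝ E] [FiniteDimensional ℝ E]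
  [MeasurableSpace E] [BorelSpace E]

lemma par_bound {ψ : ℝ → ℝ} (hψ : Continuous ψ) (z0 : E) :
    ∃ B : ℝ, 0 ≤ B ∧ ∀ z ∈ Metric.ball z0 1, ∀ ξ : E, ‖ξ‖ = 1 → |ψ ⟪z, ξ⟫| ≤ B := by
  obtain ⟨B, hB⟩ := (isCompact_Icc (a := -(‖z0‖+1)) (b := ‖z0‖+1)).exists_bound_of_continuousOn
    hψ.continuousOn
  refine ⟨|B|, abs_nonneg _, ?_⟩
  intro z hz ξ hξ
  refine le_trans (hB _ ?_) (le_abs_self B)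
  have h1 := abs_real_inner_le_norm z ξ
  rw [hξ, mul_one] at h1
  have h2 : ‖z‖ ≤ ‖z0‖ + 1 := by
    rw [Metric.mem_ball, dist_eq_norm] at hz
    have := norm_add_le (z - z0) z0
    simp at this
    linarith
  exact abs_le.1 (h1.trans h2)

variable {V : Type} [NormedAddCommGroup V] [NormedSpace ℝ V]

/-- the rank-one weight -/
def rk (u : E → V) (ξ : E) : E →L[ℝ] V := (innerSL ℝ ξ).smulRight (u ξ)

lemma par_int {μ : Measure E} (hμ : ∀ᵐ ξ ∂μ, ‖ξ‖ = 1) {ψ : ℝ → ℝ} (hψ : Continuous ψ)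
    {u : E → V} (hu : Integrable u μ) (z : E) : Integrable (fun ξ => ψ ⟪z, ξ⟫ • u ξ) μ := by
  obtain ⟨B, hB0, hB⟩ := par_bound hψ z
  refine Integrable.bdd_smul (C := B) hu ?_ ?_
  · exact (hψ.comp (by fun_prop)).aestronglyMeasurable
  · filter_upwards [hμ] with ξ hξ
    exact hB z (Metric.mem_ball_self one_pos) ξ hξ

lemma rk_int {μ : Measure E} (hμ : ∀ᵐ ξ ∂μ, ‖ξ‖ = 1) 
    {u : E → V} (hu : Integrable u μ) : Integrable (rk u) μ := by
  have hm : AEStronglyMeasurable (rk u) μ := by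
    have h1 : AEStronglyMeasurable (fun ξ : E => innerSL ℝ ξ) μ :=
      (innerSL ℝ (E := E)).continuous.aestronglyMeasurable
    have := (ContinuousLinearMap.smulRightL ℝ E V).aestronglyMeasurable_comp₂ h1 hu.1
    exact this
  refine hu.mono hm ?_
  filter_upwards [hμ] with ξ hξ
  unfold rk
  rw [ContinuousLinearMap.norm_smulRight_apply, innerSL_apply_norm, hξ, one_mul]

lemma par_deriv {μ : Measure E} (hμ : ∀ᵐ ξ ∂μ, ‖ξ‖ = 1) {ψ : ℝ → ℝ} (hψ : ContDiff ℝ 1 ψ)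
    {u : E → V} (hu : Integrable u μ) (z0 : E) :
    HasFDerivAt (fun z => ∫ ξ, ψ ⟪z, ξ⟫ • u ξ ∂μ) (∫ ξ, deriv ψ ⟪z0, ξ⟫ • rk u ξ ∂μ) z0 := by
  have hd : Continuous (deriv ψ) := hψ.continuous_deriv le_rfl
  obtain ⟨B, hB0, hB⟩ := par_bound hd z0
  refine hasFDerivAt_integral_of_dominated_of_fderiv_le (s := Metric.ball z0 1)
    (F' := fun z ξ => deriv ψ ⟪z, ξ⟫ • rk u ξ)
    (bound := fun ξ => B * ‖rk u ξ‖) (Metric.ball_mem_nhds z0 one_pos) ?_ ?_ ?_ ?_ ?_ ?_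
  · exact Filter.Eventually.of_forall fun z => (par_int hμ hψ.continuous hu z).1
  · exact par_int hμ hψ.continuous hu z0
  · exact (par_int hμ hd (rk_int hμ hu) z0).1
  · filter_upwards [hμ] with ξ hξ z hz
    rw [norm_smul]
    exact mul_le_mul_of_nonneg_right (hB z hz ξ hξ) (norm_nonneg _)
  · exact (rk_int hμ hu).norm.const_mul B
  · refine Filter.Eventually.of_forall fun ξ z _ => ?_
    have h1 : HasFDerivAt (fun z : E => ⟪z, ξ⟫) (innerSL ℝ ξ) z := by
      have := (innerSL ℝ ξ).hasFDerivAt (x := z)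
      refine this.congr_of_eventuallyEq (Filter.Eventually.of_forall fun y => ?_)
      simp [real_inner_comm]
    have h2 := ((hψ.differentiable one_ne_zero) ⟪z, ξ⟫).hasDerivAt.comp_hasFDerivAt z h1
    have h3 := h2.smul_const (u ξ)
    refine HasFDerivAt.congr_fderiv h3 ?_
    ext v
    simp [rk, smul_smul]

end paramint

lemma par_contDiff {E : Type} [NormedAddCommGroup E] [InnerProductSpace ℝ E] [FiniteDimensional ℝ E]
  [MeasurableSpace E] [BorelSpace E] {μ : Measure E} (hμ : ∀ᵐ ξ ∂μ, ‖ξ‖ = 1) (k : ℕ) :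
    ∀ {V : Type} [NormedAddCommGroup V] [NormedSpace ℝ V] {ψ : ℝ → ℝ} (_ : ContDiff ℝ (⊤ : ℕ∞) ψ)
    {u : E → V} (_ : Integrable u μ), ContDiff ℝ k (fun z => ∫ ξ, ψ ⟪z, ξ⟫ • u ξ ∂μ) := by
  induction k with
  | zero =>
    intro V _ _ ψ hψ u hu
    refine contDiff_zero.2 (continuous_iff_continuousAt.2 fun z => ?_)
    exact (par_deriv hμ (hψ.of_le (by exact_mod_cast le_top)) hu z).continuousAt
  | succ k ih =>
    intro V _ _ ψ hψ u hu
    rw [Nat.cast_succ, contDiff_succ_iff_hasFDerivAt]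
    refine ⟨_, ih (ψ := deriv ψ) ?_ (rk_int hμ hu), fun z => par_deriv hμ (hψ.of_le (by exact_mod_cast le_top)) hu z⟩
    exact (contDiff_infty_iff_deriv.1 hψ).2

/-- great-circle curve -/
lemma gam_deriv {E : Type} [NormedAddCommGroup E] [InnerProductSpace ℝ E] (e v : E) (s : ℝ) :
    HasDerivAt (fun s : ℝ => (Real.sqrt (1 + s^2))⁻¹ • (e + s • v))
     ((-s / ((1+s^2) * Real.sqrt (1+s^2))) • (e + s • v) + (Real.sqrt (1 + s^2))⁻¹ • v) s := by
  have hp : 0 < 1 + s^2 := by positivity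
  have h1 : HasDerivAt (fun s : ℝ => 1 + s^2) (2*s) s := by
    simpa using (hasDerivAt_pow 2 s).const_add 1
  have h2 := (h1.sqrt hp.ne').inv (Real.sqrt_ne_zero'.2 hp)
  have h3 : HasDerivAt (fun s : ℝ => e + s • v) v s := by
    simpa using ((hasDerivAt_id s).smul_const v).const_add e
  have h4 := h2.smul h3
  refine HasDerivAt.congr_deriv h4 ?_
  rw [add_comm]
  congr 2
  rw [Real.sq_sqrt hp.le]
  have := Real.sqrt_ne_zero'.2 hp
  field_simp

lemma gam_deriv2 {E : Type} [NormedAddCommGroup E] [InnerProductSpace ℝ E] (e v : E) :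
    HasDerivAt (fun s : ℝ => (-s / ((1+s^2) * Real.sqrt (1+s^2))) • (e + s • v)
      + (Real.sqrt (1 + s^2))⁻¹ • v) (-e) 0 := by
  have hp : (0:ℝ) < 1 + 0^2 := by positivity
  have h1 : HasDerivAt (fun s : ℝ => 1 + s^2) (2*0) 0 := by
    simpa using (hasDerivAt_pow 2 (0:ℝ)).const_add 1
  have h2 := ((h1.sqrt hp.ne').inv (Real.sqrt_ne_zero'.2 hp)).smul_const v
  have h3 : HasDerivAt (fun s : ℝ => e + s • v) v 0 := by
    simpa using ((hasDerivAt_id (0:ℝ)).smul_const v).const_add e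
  have h5 := ((hasDerivAt_id (0:ℝ)).neg.div (h1.mul (h1.sqrt hp.ne')) (by simp)).smul h3
  have h6 := h5.add h2
  refine HasDerivAt.congr_deriv h6 ?_
  simp

/-- second derivative along the great circle -/
lemma par_curve {d : ℕ} {μ : Measure (En (d+1))} (hμ : ∀ᵐ ξ ∂μ, ‖ξ‖ = 1)
    {ψ : ℝ → ℝ} (hψ : ContDiff ℝ (⊤ : ℕ∞) ψ)
    {u : En (d+1) → ℝ} (hu : Integrable u μ) (e v : En (d+1)) :
    ∃ F' : ℝ → ℝ, (∀ s, HasDerivAt (fun s : ℝ => ∫ ξ, ψ ⟪(Real.sqrt (1 + s^2))⁻¹ • (e + s • v), ξ⟫ • u ξ ∂μ)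
      (F' s) s) ∧ HasDerivAt F'
      (∫ ξ, (deriv (deriv ψ) ⟪e, ξ⟫ * ⟪v, ξ⟫^2 - deriv ψ ⟪e,ξ⟫ * ⟪e, ξ⟫) * u ξ ∂μ) 0 := by
  have hψ1 : ContDiff ℝ 1 ψ := hψ.of_le (by exact_mod_cast le_top)
  have hψ' : ContDiff ℝ (⊤ : ℕ∞) (deriv ψ) := (contDiff_infty_iff_deriv.1 hψ).2
  have hψ'1 : ContDiff ℝ 1 (deriv ψ) := hψ'.of_le (by exact_mod_cast le_top)
  have hψ'' : Continuous (deriv (deriv ψ)) := hψ'1.continuous_deriv le_rfl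
  refine ⟨_, fun s => (par_deriv hμ hψ1 hu _).comp_hasDerivAt s (gam_deriv e v s), ?_⟩
  have h0 : (Real.sqrt (1 + (0:ℝ)^2))⁻¹ • (e + (0:ℝ) • v) = e := by simp
  have h1 := (par_deriv hμ hψ'1 (rk_int hμ hu) ((Real.sqrt (1 + (0:ℝ)^2))⁻¹ • (e + (0:ℝ) • v))).comp_hasDerivAt 0 (gam_deriv e v 0)
  have h2 := h1.clm_apply (gam_deriv2 e v)
  refine HasDerivAt.congr_deriv h2 ?_
  have i1 := par_int hμ hψ'' (rk_int hμ (rk_int hμ hu)) e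
  have i2 := par_int hμ hψ'1.continuous (rk_int hμ hu) e
  simp only [Function.comp_apply, h0]
  simp only [neg_zero, zero_div, zero_smul, zero_add, add_zero, ne_eq, OfNat.ofNat_ne_zero, not_false_eq_true, zero_pow, Real.sqrt_one, inv_one, one_smul]
  rw [ContinuousLinearMap.integral_apply i1, ContinuousLinearMap.integral_apply i2,
    ContinuousLinearMap.integral_apply (i1.apply_continuousLinearMap v), ← integral_add]
  · congr 1
    ext ξ
    simp [rk, real_inner_comm]
    ring
  · exact (i1.apply_continuousLinearMap v).apply_continuousLinearMap v
  · exact i2.apply_continuousLinearMap _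

end


section

def eN (d : ℕ) : En (d+1) := EuclideanSpace.single (Fin.last d) 1

lemma inner_eN (d : ℕ) (ξ : En (d+1)) : ⟪eN d, ξ⟫ = ξ (Fin.last d) := by
  simp [eN, EuclideanSpace.inner_single_left]

lemma inner_std (d : ℕ) (i : Fin (d+1)) (ξ : En (d+1)) : ⟪stdB (d+1) i, ξ⟫ = ξ i := by
  simp [stdB, EuclideanSpace.inner_single_left]

lemma norm_eN (d : ℕ) : ‖eN d‖ = 1 := by simp [eN]

/-- reflection swapping two vectors of equal norm -/
lemma exists_swap_isom {d : ℕ} (u v : En (d+1)) (h : ‖u‖ = ‖v‖) :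
    ∃ T : En (d+1) ≃ₗᵢ[ℝ] En (d+1), T u = v ∧ T v = u := by
  refine ⟨Submodule.reflection (ℝ ∙ (u - v))ᗮ, Submodule.reflection_sub h, ?_⟩
  have := Submodule.reflection_sub h
  rw [← this]
  conv_rhs => rw [← Submodule.reflection_reflection (ℝ ∙ (u - v))ᗮ u]
  rw [this]

lemma norm_gam {d : ℕ} (i : Fin d) (s : ℝ) :
    ‖(Real.sqrt (1 + s^2))⁻¹ • (eN d + s • stdB (d+1) i.castSucc)‖ = 1 := by
  have hp : 0 < 1 + s^2 := by positivity
  have h : ‖eN d + s • stdB (d+1) i.castSucc‖ = Real.sqrt (1+s^2) := by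
    rw [← Real.sqrt_sq (norm_nonneg _)]
    congr 1
    rw [← real_inner_self_eq_norm_sq]
    simp only [inner_add_left, inner_smul_left, inner_eN, inner_std]
    simp [eN, stdB, Fin.castSucc_ne_last, (Fin.castSucc_ne_last i).symm]
    ring
  rw [norm_smul, h, norm_inv, Real.norm_of_nonneg (Real.sqrt_nonneg _)]
  exact inv_mul_cancel₀ (Real.sqrt_ne_zero'.2 hp)

lemma sph_inv {d : ℕ} (ψ : ℝ → ℝ) (z : En (d+1)) (hz : ‖z‖ = 1) :
    ∫ ξ, ψ ⟪z, ξ⟫ ∂(sig d) = ∫ ξ, ψ ⟪eN d, ξ⟫ ∂(sig d) := by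
  obtain ⟨T, h1, h2⟩ := exists_swap_isom z (eN d) (by rw [hz, norm_eN])
  rw [← (sig_mp d T).integral_comp T.toHomeomorph.measurableEmbedding (fun ξ => ψ ⟪eN d, ξ⟫)]
  congr 1
  ext ξ
  rw [← h1, T.inner_map_map]

lemma sum_sq {d : ℕ} (ξ : En (d+1)) (h : ‖ξ‖ = 1) :
    ∑ i : Fin d, ξ i.castSucc ^2 = 1 - ξ (Fin.last d)^2 := by
  have := EuclideanSpace.real_norm_sq_eq ξ
  rw [Fin.sum_univ_castSucc, h] at this
  linarith

lemma sph_id {d : ℕ} {ψ : ℝ → ℝ} (hψ : ContDiff ℝ (⊤ : ℕ∞) ψ) :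
    ∫ ξ, (deriv (deriv ψ) (ξ (Fin.last d)) * (1 - ξ (Fin.last d)^2)
      - d * (deriv ψ (ξ (Fin.last d)) * ξ (Fin.last d))) ∂(sig d) = 0 := by
  have hψ' : ContDiff ℝ (⊤ : ℕ∞) (deriv ψ) := (contDiff_infty_iff_deriv.1 hψ).2
  have hψ'' : Continuous (deriv (deriv ψ)) := (contDiff_infty_iff_deriv.1 hψ').2.continuous
  have key : ∀ i : Fin d, ∫ ξ, (deriv (deriv ψ) (ξ (Fin.last d)) * (ξ i.castSucc)^2
      - deriv ψ (ξ (Fin.last d)) * ξ (Fin.last d)) ∂(sig d) = 0 := by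
    intro i
    obtain ⟨F', h1, h2⟩ := par_curve (sig_ae d) hψ (u := fun _ => (1:ℝ)) (integrable_const _) (eN d)
      (stdB (d+1) i.castSucc)
    have hF : F' = fun _ => 0 := by
      ext s
      refine (h1 s).unique ?_
      refine (hasDerivAt_const s (∫ ξ, ψ ⟪eN d, ξ⟫ ∂(sig d))).congr_of_eventuallyEq ?_
      refine Filter.Eventually.of_forall fun t => ?_
      simp only [smul_eq_mul, mul_one]
      exact sph_inv ψ _ (norm_gam i t)
    rw [hF] at h2
    have := h2.unique (hasDerivAt_const 0 0)
    simpa only [inner_eN, inner_std, mul_one] using this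
  have hint : ∀ g : En (d+1) → ℝ, Continuous g → Integrable g (sig d) := by
    intro g hg
    unfold sig
    have := sig_finite d
    have hfin : μH[(d:ℝ)] (Metric.sphere (0 : En (d+1)) 1) < ⊤ := by
      have := this.1
      unfold sig at this
      rwa [Measure.restrict_apply_univ] at this
    refine Integrable.mono' (g := fun _ => ‖(isCompact_sphere (0 : En (d+1)) 1).exists_bound_of_continuousOn hg.continuousOn |>.choose‖) ?_ hg.aestronglyMeasurable ?_
    · have := sig_finite d
      unfold sig at this
      exact integrable_const _
    · have hc := (isCompact_sphere (0 : En (d+1)) 1).exists_bound_of_continuousOn hg.continuousOn |>.choose_spec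
      filter_upwards [ae_restrict_mem Metric.isClosed_sphere.measurableSet] with ξ hξ
      exact (hc ξ hξ).trans (le_abs_self _)
  have hc : ∀ j, Continuous (fun ξ : En (d+1) => ξ j) := fun j => by fun_prop
  have hsum : ∑ i : Fin d, ∫ ξ, (deriv (deriv ψ) (ξ (Fin.last d)) * (ξ i.castSucc)^2
      - deriv ψ (ξ (Fin.last d)) * ξ (Fin.last d)) ∂(sig d) = 0 :=
    Finset.sum_eq_zero fun i _ => key i
  rw [← integral_finsetSum] at hsum
  · rw [← hsum]
    refine integral_congr_ae ?_
    filter_upwards [sig_ae d] with ξ hξ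
    rw [Finset.sum_sub_distrib, ← Finset.mul_sum, sum_sq ξ hξ]
    simp
  · intro i _
    refine hint _ ?_
    exact ((hψ''.comp (hc _)).mul ((hc _).pow 2)).sub ((hψ'.continuous.comp (hc _)).mul (hc _))

/-- pushforward of the sphere measure under the last coordinate -/
def nuM (d : ℕ) : Measure ℝ := (sig d).map (fun ξ => ξ (Fin.last d))

lemma meas_last (d : ℕ) : Measurable (fun ξ : En (d+1) => ξ (Fin.last d)) :=
  (by fun_prop : Continuous (fun ξ : En (d+1) => ξ (Fin.last d))).measurable

instance nuM_fin (d : ℕ) : IsFiniteMeasure (nuM d) := by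
  unfold nuM; infer_instance

lemma nuM_ae (d : ℕ) : ∀ᵐ t ∂(nuM d), t ∈ Set.Icc (-1:ℝ) 1 := by
  unfold nuM
  refine (ae_map_iff (p := fun t => t ∈ Set.Icc (-1:ℝ) 1) (meas_last d).aemeasurable measurableSet_Icc).2 ?_
  filter_upwards [sig_ae d] with ξ hξ
  have := PiLp.norm_apply_le ξ (Fin.last d)
  rw [hξ] at this
  exact abs_le.1 this

lemma int_of_Icc {μ : Measure ℝ} [IsFiniteMeasure μ] (hμ : ∀ᵐ t ∂μ, t ∈ Set.Icc (-1:ℝ) 1)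
    {g : ℝ → ℝ} (hg : Continuous g) : Integrable g μ := by
  obtain ⟨B, hB⟩ := (isCompact_Icc (a := (-1:ℝ)) (b := 1)).exists_bound_of_continuousOn hg.continuousOn
  refine Integrable.mono' (integrable_const B) hg.aestronglyMeasurable ?_
  filter_upwards [hμ] with t ht using hB t ht

lemma nuM_id {d : ℕ} {ψ : ℝ → ℝ} (hψ : ContDiff ℝ (⊤ : ℕ∞) ψ) :
    ∫ t, (deriv (deriv ψ) t * (1 - t^2) - d * (deriv ψ t * t)) ∂(nuM d) = 0 := by
  have hψ' : ContDiff ℝ (⊤ : ℕ∞) (deriv ψ) := (contDiff_infty_iff_deriv.1 hψ).2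
  have hψ'' : Continuous (deriv (deriv ψ)) := (contDiff_infty_iff_deriv.1 hψ').2.continuous
  have hψ'c := hψ'.continuous
  unfold nuM
  rw [integral_map (meas_last d).aemeasurable]
  · exact sph_id hψ
  · exact Continuous.aestronglyMeasurable (by fun_prop)

lemma nuM_one {d : ℕ} (hd : d ≠ 0) : ∫ t, t^1 ∂(nuM d) = 0 := by
  have := nuM_id (d := d) (ψ := fun t => t) contDiff_id
  simp [integral_neg] at this
  rw [integral_const_mul] at this
  simpa [hd] using this

lemma nuM_rec (d k : ℕ) : ((k:ℝ)+1) * ∫ t, t^k ∂(nuM d) = (d + k + 1) * ∫ t, t^(k+2) ∂(nuM d) := by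
  have h := nuM_id (d := d) (ψ := fun t => t^(k+2)) (contDiff_id.pow _)
  have e1 : deriv (fun t : ℝ => t^(k+2)) = fun t => ((k:ℝ)+2) * t^(k+1) := by
    ext t; simp
  have e2 : deriv (fun t : ℝ => ((k:ℝ)+2) * t^(k+1)) = fun t => ((k:ℝ)+2) * (((k:ℝ)+1) * t^k) := by
    ext t; simp
  rw [e1, e2] at h
  have e3 : (fun t : ℝ => ((k:ℝ)+2) * (((k:ℝ)+1) * t^k) * (1-t^2) - d * (((k:ℝ)+2) * t^(k+1) * t))
    = fun t => (k+2) * (((k:ℝ)+1) * t^k - (d + k + 1) * t^(k+2)) := by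
    ext t; ring
  rw [e3, integral_const_mul, integral_sub, integral_const_mul, integral_const_mul] at h
  · have : ((k:ℝ)+2) ≠ 0 := by positivity
    have := (mul_eq_zero.1 h).resolve_left this
    linarith
  · exact int_of_Icc (nuM_ae d) (by fun_prop)
  · exact int_of_Icc (nuM_ae d) (by fun_prop)

lemma meas_ext_moments {μ ν : Measure ℝ} [IsFiniteMeasure μ] [IsFiniteMeasure ν]
    (hμ : ∀ᵐ t ∂μ, t ∈ Set.Icc (-1:ℝ) 1) (hν : ∀ᵐ t ∂ν, t ∈ Set.Icc (-1:ℝ) 1)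
    (h : ∀ k : ℕ, ∫ t, t^k ∂μ = ∫ t, t^k ∂ν) : μ = ν := by
  have hpoly : ∀ p : Polynomial ℝ, ∫ t, p.eval t ∂μ = ∫ t, p.eval t ∂ν := by
    intro p
    simp only [Polynomial.eval_eq_sum_range]
    rw [integral_finsetSum, integral_finsetSum]
    · refine Finset.sum_congr rfl fun k _ => ?_
      rw [integral_const_mul, integral_const_mul, h k]
    · intro k _; exact int_of_Icc hν (by fun_prop)
    · intro k _; exact int_of_Icc hμ (by fun_prop)
  refine ext_of_forall_integral_eq_of_IsFiniteMeasure fun f => ?_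
  refine eq_of_abs_sub_le_all fun ε hε => ?_
  set A := μ.real Set.univ + ν.real Set.univ + 1 with hA
  have hA0 : 0 < A := by positivity
  obtain ⟨p, hp⟩ := exists_polynomial_near_of_continuousOn (-1) 1 f f.continuous.continuousOn (ε/A) (by positivity)
  have b : ∀ (ρ : Measure ℝ) [IsFiniteMeasure ρ], (∀ᵐ t ∂ρ, t ∈ Set.Icc (-1:ℝ) 1) →
      |∫ t, p.eval t ∂ρ - ∫ t, f t ∂ρ| ≤ ε/A * ρ.real Set.univ := by
    intro ρ _ hρ
    rw [← integral_sub (int_of_Icc hρ p.continuous) (int_of_Icc hρ f.continuous)]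
    refine norm_integral_le_of_norm_le_const (μ := ρ) (f := fun t => p.eval t - f t) (C := ε/A) ?_
    filter_upwards [hρ] with t ht using (hp t ht).le
  have b1 := b μ hμ
  have b2 := b ν hν
  rw [hpoly p] at b1
  have : ε/A * μ.real Set.univ + ε/A * ν.real Set.univ ≤ ε := by
    rw [← mul_add, div_mul_eq_mul_div, div_le_iff₀ hA0]
    have : μ.real Set.univ + ν.real Set.univ ≤ A := by linarith
    nlinarith
  rw [abs_le] at *
  constructor <;> linarith [b1.1, b1.2, b2.1, b2.2]

end


section

def wt (p : ℕ) (t : ℝ) : ℝ := (1 - t^2)^p * Real.sqrt (1 - t^2)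

lemma wt_cont (p : ℕ) : Continuous (wt p) := by unfold wt; fun_prop

lemma wt_nonneg (p : ℕ) {t : ℝ} (ht : t ∈ Set.Icc (-1:ℝ) 1) : 0 ≤ wt p t := by
  have : 0 ≤ 1 - t^2 := by nlinarith [ht.1, ht.2]
  unfold wt; positivity

lemma wt_pos (p : ℕ) {t : ℝ} (ht : t ∈ Set.Ioo (-1:ℝ) 1) : 0 < wt p t := by
  have : 0 < 1 - t^2 := by nlinarith [ht.1, ht.2]
  unfold wt; positivity

lemma wt_deriv (p : ℕ) {t : ℝ} (ht : t ∈ Set.Ioo (-1:ℝ) 1) :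
    HasDerivAt (wt (p+1)) (-(2*p+3) * t * wt p t) t := by
  have hp : 0 < 1 - t^2 := by nlinarith [ht.1, ht.2]
  have h1 : HasDerivAt (fun s : ℝ => 1 - s^2) (-(2*t)) t := by
    simpa using (hasDerivAt_pow 2 t).const_sub 1
  have h2 := (h1.pow (p+1)).mul (h1.sqrt hp.ne')
  refine HasDerivAt.congr_deriv h2 ?_
  unfold wt
  have hs : Real.sqrt (1-t^2) ^ 2 = 1 - t^2 := Real.sq_sqrt hp.le
  have hs0 : Real.sqrt (1-t^2) ≠ 0 := Real.sqrt_ne_zero'.2 hp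
  simp only [Pi.pow_apply, Nat.cast_add, Nat.cast_one, Nat.add_sub_cancel]
  field_simp
  rw [hs]
  ring

lemma wt_succ (p : ℕ) (t : ℝ) : wt (p+1) t = (1-t^2) * wt p t := by unfold wt; ring

lemma wt_end (p : ℕ) : wt (p+1) 1 = 0 ∧ wt (p+1) (-1) = 0 := by unfold wt; simp

lemma wm_rec (p k : ℕ) : ((k:ℝ)+1) * ∫ t in (-1:ℝ)..1, t^k * wt p t
    = ((2*p+3:ℕ) + k + 1) * ∫ t in (-1:ℝ)..1, t^(k+2) * wt p t := by
  have hc := wt_cont p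
  have h := intervalIntegral.integral_eq_sub_of_hasDerivAt_of_le (a := -1) (b := 1)
    (f := fun t => t^(k+1) * wt (p+1) t)
    (f' := fun t => ((k:ℝ)+1) * (t^k * wt p t) - ((2*p+3:ℕ) + k + 1) * (t^(k+2) * wt p t)) (by norm_num)
    (Continuous.continuousOn ((continuous_pow _).mul (wt_cont _))) ?_
    (Continuous.intervalIntegrable (by fun_prop) _ _)
  · rw [intervalIntegral.integral_sub, intervalIntegral.integral_const_mul,
      intervalIntegral.integral_const_mul, (wt_end p).1, (wt_end p).2] at h
    · linarith
    · exact Continuous.intervalIntegrable (by fun_prop) _ _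
    · exact Continuous.intervalIntegrable (by fun_prop) _ _
  · intro t ht
    have := (hasDerivAt_pow (k+1) t).mul (wt_deriv p ht)
    refine HasDerivAt.congr_deriv this ?_
    rw [wt_succ]
    push_cast
    ring

lemma wm_one (p : ℕ) : ∫ t in (-1:ℝ)..1, t^1 * wt p t = 0 := by
  have hc := wt_cont p
  have h := intervalIntegral.integral_eq_sub_of_hasDerivAt_of_le (a := -1) (b := 1)
    (f := fun t => wt (p+1) t)
    (f' := fun t => (-(2*p+3):ℝ) * (t^1 * wt p t)) (by norm_num)
    (Continuous.continuousOn (wt_cont _)) ?_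
    (Continuous.intervalIntegrable (by fun_prop) _ _)
  · rw [intervalIntegral.integral_const_mul, (wt_end p).1, (wt_end p).2, sub_zero] at h
    refine (mul_eq_zero.1 h).resolve_left ?_
    have : (0:ℝ) < 2*p+3 := by positivity
    linarith
  · intro t ht
    refine HasDerivAt.congr_deriv (wt_deriv p ht) ?_
    ring

lemma wm_zero (p : ℕ) : 0 < ∫ t in (-1:ℝ)..1, wt p t :=
  intervalIntegral.intervalIntegral_pos_of_pos_on ((wt_cont p).intervalIntegrable _ _)
    (fun _ ht => wt_pos p ht) (by norm_num)

def tau (p : ℕ) (c : ℝ) : Measure ℝ :=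
  (volume.restrict (Set.Ioc (-1:ℝ) 1)).withDensity (fun t => ENNReal.ofReal (c * wt p t))

lemma tau_meas (p : ℕ) (c : ℝ) : Measurable (fun t => ENNReal.ofReal (c * wt p t)) := by
  have := wt_cont p
  exact ENNReal.measurable_ofReal.comp (by fun_prop : Continuous fun t => c * wt p t).measurable

lemma tau_int (p : ℕ) {c : ℝ} (hc : 0 ≤ c) (f : ℝ → ℝ) :
    ∫ t, f t ∂(tau p c) = ∫ t in (-1:ℝ)..1, c * wt p t * f t := by
  unfold tau
  rw [integral_withDensity_eq_integral_toReal_smul (tau_meas p c) (by simp),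
    intervalIntegral.integral_of_le (by norm_num)]
  refine setIntegral_congr_fun measurableSet_Ioc fun t ht => ?_
  simp only [smul_eq_mul]
  rw [ENNReal.toReal_ofReal (mul_nonneg hc (wt_nonneg p (Set.Ioc_subset_Icc_self ht)))]

lemma tau_fin (p : ℕ) (c : ℝ) : IsFiniteMeasure (tau p c) := by
  unfold tau
  refine isFiniteMeasure_withDensity_ofReal ?_
  have := wt_cont p
  have : IntegrableOn (fun t => c * wt p t) (Set.Ioc (-1) 1) volume :=
    ((by fun_prop : Continuous fun t => c * wt p t).integrableOn_Icc).mono_set Set.Ioc_subset_Icc_self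
  exact this.2

lemma tau_ae (p : ℕ) (c : ℝ) : ∀ᵐ t ∂(tau p c), t ∈ Set.Icc (-1:ℝ) 1 := by
  unfold tau
  refine (withDensity_absolutelyContinuous _ _).ae_le ?_
  filter_upwards [ae_restrict_mem measurableSet_Ioc] with t ht using Set.Ioc_subset_Icc_self ht

lemma nuM_eq (p : ℕ) : ∃ c : ℝ, 0 < c ∧ nuM (2*p+3) = tau p c := by
  set b : ℕ → ℝ := fun k => ∫ t in (-1:ℝ)..1, t^k * wt p t with hb
  set a : ℕ → ℝ := fun k => ∫ t, t^k ∂(nuM (2*p+3)) with ha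
  have hb0 : 0 < b 0 := by simpa [hb] using wm_zero p
  have ha0 : 0 < a 0 := by
    simp only [ha, pow_zero, integral_const, smul_eq_mul, mul_one]
    rw [measureReal_def, ENNReal.toReal_pos_iff]
    refine ⟨?_, measure_lt_top _ _⟩
    unfold nuM
    rw [Measure.map_apply (meas_last _) MeasurableSet.univ]
    exact pos_iff_ne_zero.2 (sig_ne_zero _)
  refine ⟨a 0 / b 0, by positivity, ?_⟩
  have := tau_fin p (a 0 / b 0)
  refine meas_ext_moments (nuM_ae _) (tau_ae _ _) ?_
  have hab : ∀ k, a k = a 0 / b 0 * b k := by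
    intro k
    induction k using Nat.twoStepInduction with
    | zero => field_simp
    | one =>
      have h1 : a 1 = 0 := nuM_one (by omega)
      have h2 : b 1 = 0 := wm_one p
      rw [h1, h2, mul_zero]
    | more k ih _ =>
      have h1 : ((k:ℝ)+1) * a k = ((2*p+3:ℕ) + k + 1) * a (k+2) := nuM_rec (2*p+3) k
      have h2 : ((k:ℝ)+1) * b k = ((2*p+3:ℕ) + k + 1) * b (k+2) := wm_rec p k
      rw [ih] at h1
      have h3 : (((2*p+3:ℕ):ℝ) + k + 1) ≠ 0 := by positivity
      apply mul_left_cancel₀ h3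
      rw [← h1, mul_left_comm, mul_left_comm _ (a 0 / b 0), ← h2]
  intro k
  rw [tau_int p (by positivity)]
  refine (hab k).trans ?_
  rw [hb]
  simp only
  rw [← intervalIntegral.integral_const_mul]
  congr 1
  ext t
  ring

/-- half-sphere integrals -/
lemma half_int (p : ℕ) {c : ℝ} (hc : 0 < c) (h : nuM (2*p+3) = tau p c) (f : ℝ → ℝ) (hf : Measurable f) :
    ∫ ξ in {ξ : En (2*p+3+1) | 0 < ξ (Fin.last (2*p+3))}, f (ξ (Fin.last (2*p+3))) ∂(sig (2*p+3))
      = c * ∫ t in (0:ℝ)..1, wt p t * f t := by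
  rw [← integral_indicator (measurableSet_lt measurable_const (meas_last _))]
  have e : (Set.indicator {ξ : En (2*p+3+1) | 0 < ξ (Fin.last (2*p+3))}
      (fun ξ => f (ξ (Fin.last (2*p+3))))) = fun ξ => (Set.Ioi (0:ℝ)).indicator f (ξ (Fin.last (2*p+3))) := by
    ext ξ
    simp [Set.indicator]
  rw [e, ← integral_map (meas_last _).aemeasurable (hf.indicator measurableSet_Ioi).aestronglyMeasurable]
  have := tau_int p hc.le ((Set.Ioi (0:ℝ)).indicator f)
  rw [← h] at this
  refine this.trans ?_
  rw [← intervalIntegral.integral_const_mul, intervalIntegral.integral_of_le (by norm_num),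
    intervalIntegral.integral_of_le (by norm_num)]
  have e2 : (fun t => c * wt p t * (Set.Ioi (0:ℝ)).indicator f t) =
    (Set.Ioi (0:ℝ)).indicator (fun t => c * (wt p t * f t)) := by
    ext t
    simp only [Set.indicator]
    split_ifs <;> ring
  rw [e2, setIntegral_indicator measurableSet_Ioi]
  congr 2
  ext t
  simp only [Set.mem_inter_iff, Set.mem_Ioc, Set.mem_Ioi]
  constructor
  · rintro ⟨⟨_, h1⟩, h2⟩; exact ⟨h2, h1⟩
  · rintro ⟨h1, h2⟩; exact ⟨⟨by linarith, h2⟩, h1⟩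

lemma log_integrable (p : ℕ) {c : ℝ} (h : nuM (2*p+3) = tau p c) :
    Integrable (fun ξ : En (2*p+3+1) => Real.log (ξ (Fin.last (2*p+3)))) (sig (2*p+3)) := by
  have h1 : Integrable Real.log (nuM (2*p+3)) := by
    rw [h]
    unfold tau
    rw [integrable_withDensity_iff_integrable_smul' (tau_meas p c) (by simp)]
    have hlog : IntegrableOn Real.log (Set.Ioc (-1) 1) volume :=
      (intervalIntegrable_iff_integrableOn_Ioc_of_le (by norm_num)).1
        (intervalIntegral.intervalIntegrable_log' (a := -1) (b := 1))
    have hw := wt_cont p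
    obtain ⟨B, hB⟩ := (isCompact_Icc (a := (-1:ℝ)) (b := 1)).exists_bound_of_continuousOn
      (by fun_prop : Continuous fun t => c * wt p t).continuousOn
    refine Integrable.bdd_smul (φ := fun t => (ENNReal.ofReal (c * wt p t)).toReal) (f := Real.log) (C := |B|) hlog ?_ ?_
    · exact (tau_meas p c).ennreal_toReal.aestronglyMeasurable
    · filter_upwards [ae_restrict_mem measurableSet_Ioc] with t ht
      have := hB t (Set.Ioc_subset_Icc_self ht)
      rw [ENNReal.toReal_ofReal', Real.norm_eq_abs] at *
      refine le_trans ?_ (this.trans (le_abs_self B))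
      rw [abs_of_nonneg (le_max_right _ _)]
      exact max_le (le_abs_self _) (abs_nonneg _)
  exact h1.comp_measurable (meas_last _)

end


section

lemma second_dir {E : Type} [NormedAddCommGroup E] [NormedSpace ℝ E] {f : E → ℝ} {x : E}
    (hf : ContDiffAt ℝ 2 f x) (v : E) {F' : ℝ → ℝ} {a : ℝ}
    (h1 : ∀ᶠ s in nhds (0:ℝ), HasDerivAt (fun s : ℝ => f (x + s • v)) (F' s) s)
    (h2 : HasDerivAt F' a 0) : iteratedFDeriv ℝ 2 f x (fun _ => v) = a := by
  rw [iteratedFDeriv_two_apply]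
  have hline : ∀ s, HasDerivAt (fun s : ℝ => x + s • v) v s := by
    intro s
    simpa using ((hasDerivAt_id s).smul_const v).const_add x
  have hx : x + (0:ℝ) • v = x := by simp
  have hdiff : DifferentiableAt ℝ (fderiv ℝ f) x :=
    (hf.fderiv_right (m := 1) (le_of_eq one_add_one_eq_two)).differentiableAt one_ne_zero
  have hev : ∀ᶠ y in nhds x, DifferentiableAt ℝ f y := by
    filter_upwards [hf.eventually (by decide)] with y hy using hy.differentiableAt two_ne_zero
  have htend : Filter.Tendsto (fun s : ℝ => x + s • v) (nhds 0) (nhds x) := by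
    have := (hline 0).continuousAt.tendsto
    rwa [hx] at this
  have h3 : F' =ᶠ[nhds 0] fun s => fderiv ℝ f (x + s • v) v := by
    filter_upwards [h1, htend.eventually hev] with s hs hd
    exact hs.unique (hd.hasFDerivAt.comp_hasDerivAt s (hline s))
  have h4 : HasFDerivAt (fderiv ℝ f) (fderiv ℝ (fderiv ℝ f) x) (x + (0:ℝ) • v) := by
    rw [hx]; exact hdiff.hasFDerivAt
  have h5 := h4.comp_hasDerivAt 0 (hline 0)
  have h5' := (ContinuousLinearMap.apply ℝ ℝ v).hasFDerivAt.comp_hasDerivAt 0 h5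
  exact Eq.symm (h2.unique (h5'.congr_of_eventuallyEq h3))

def halfM (d : ℕ) : Measure (En (d+1)) := (sig d).restrict {ξ | 0 < ξ (Fin.last d)}

lemma halfM_ae (d : ℕ) : ∀ᵐ ξ ∂(halfM d), ‖ξ‖ = 1 := ae_restrict_of_ae (sig_ae d)

instance (d : ℕ) : IsFiniteMeasure (halfM d) := by unfold halfM; infer_instance

def Gphi (d : ℕ) (φ : ℝ → ℝ) (y : En (d+1)) : ℝ :=
  ∫ ξ in {ξ : En (d+1) | ‖ξ‖ = 1 ∧ 0 < ⟪y, ξ⟫}, Real.log ⟪y, ξ⟫ * φ (ξ (Fin.last d)) ∂μH[(d:ℝ)]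

lemma Gphi_eq {d : ℕ} {φ : ℝ → ℝ} (hφ : ContDiff ℝ (⊤ : ℕ∞) φ)
    (hlog : Integrable (fun ξ : En (d+1) => Real.log (ξ (Fin.last d))) (sig d)) (y : En (d+1)) (hy : y ≠ 0) :
    Gphi d φ y = Real.log ‖y‖ * (∫ ξ, φ ⟪‖y‖⁻¹ • y, ξ⟫ • (1:ℝ) ∂(halfM d))
      + ∫ ξ, φ ⟪‖y‖⁻¹ • y, ξ⟫ • Real.log (ξ (Fin.last d)) ∂(halfM d) := by
  have hy0 : 0 < ‖y‖ := norm_pos_iff.2 hy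
  set u := ‖y‖⁻¹ • y with hu
  have hun : ‖u‖ = 1 := by rw [hu, norm_smul, norm_inv, norm_norm, inv_mul_cancel₀ hy0.ne']
  have hyu : y = ‖y‖ • u := by rw [hu, smul_smul, mul_inv_cancel₀ hy0.ne', one_smul]
  obtain ⟨T, hT1, hT2⟩ := exists_swap_isom u (eN d) (by rw [hun, norm_eN])
  have i1 := par_int (halfM_ae d) hφ.continuous (u := fun _ => (1:ℝ)) (integrable_const _) u
  have i2 := par_int (halfM_ae d) hφ.continuous (u := fun ξ => Real.log (ξ (Fin.last d))) hlog.restrict u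
  rw [← integral_const_mul, ← integral_add (i1.const_mul _) i2]
  have hmS : MeasurableSet {ξ : En (d+1) | 0 < ⟪y, ξ⟫} :=
    (isOpen_lt continuous_const (by fun_prop)).measurableSet
  have hset : {ξ : En (d+1) | ‖ξ‖ = 1 ∧ 0 < ⟪y, ξ⟫} = {ξ | 0 < ⟪y, ξ⟫} ∩ Metric.sphere 0 1 := by
    ext ξ; simp [and_comm]
  unfold Gphi halfM
  rw [hset, ← Measure.restrict_restrict hmS]
  change ∫ ξ in {ξ | 0 < ⟪y, ξ⟫}, Real.log ⟪y, ξ⟫ * φ (ξ (Fin.last d)) ∂(sig d) = _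
  rw [← integral_indicator hmS, ← integral_indicator (measurableSet_lt measurable_const (meas_last _))]
  refine Eq.trans ?_ ((sig_mp d T).integral_comp T.toHomeomorph.measurableEmbedding _)
  congr 1
  ext ξ
  have e1 : (T ξ) (Fin.last d) = ⟪u, ξ⟫ := by rw [← inner_eN, ← hT1, T.inner_map_map]
  have e2 : ⟪u, T ξ⟫ = ξ (Fin.last d) := by rw [← inner_eN, ← hT2, T.inner_map_map]
  have e3 : ⟪y, ξ⟫ = ‖y‖ * ⟪u, ξ⟫ := by
    conv_lhs => rw [hyu]
    rw [inner_smul_left]; simp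
  have e4 : 0 < ⟪y, ξ⟫ ↔ 0 < ⟪u, ξ⟫ := by rw [e3]; exact mul_pos_iff_of_pos_left hy0
  simp only [Set.indicator, Set.mem_ofPred_eq, e1, e2, e4, smul_eq_mul, mul_one]
  split_ifs with h
  · rw [e3, Real.log_mul hy0.ne' h.ne']; ring
  · rfl

lemma Gphi_contDiff {d : ℕ} {φ : ℝ → ℝ} (hφ : ContDiff ℝ (⊤ : ℕ∞) φ)
    (hlog : Integrable (fun ξ : En (d+1) => Real.log (ξ (Fin.last d))) (sig d)) :
    ContDiffAt ℝ 2 (Gphi d φ) (eN d) := by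
  have hne : eN d ≠ 0 := by rw [← norm_ne_zero_iff, norm_eN]; exact one_ne_zero
  have hn : ContDiffAt ℝ 2 (fun y : En (d+1) => ‖y‖) (eN d) := contDiffAt_norm ℝ hne
  have hn0 : ‖eN d‖ ≠ 0 := norm_ne_zero_iff.2 hne
  have hu : ContDiffAt ℝ 2 (fun y : En (d+1) => ‖y‖⁻¹ • y) (eN d) := (hn.inv hn0).smul contDiffAt_id
  have c1 := (par_contDiff (halfM_ae d) 2 hφ (u := fun _ => (1:ℝ)) (integrable_const _))
  have c2 := (par_contDiff (halfM_ae d) 2 hφ (u := fun ξ => Real.log (ξ (Fin.last d))) hlog.restrict)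
  have c1' : ContDiff ℝ 2 _ := c1
  have c2' : ContDiff ℝ 2 _ := c2
  have := ((hn.log hn0).mul (c1'.comp_contDiffAt (eN d) hu)).add (c2'.comp_contDiffAt (eN d) hu)
  refine this.congr_of_eventuallyEq ?_
  filter_upwards [isOpen_ne.mem_nhds hne] with y hy
  exact Gphi_eq hφ hlog y hy

lemma lap_formula {d : ℕ} {φ : ℝ → ℝ} (hφ : ContDiff ℝ (⊤ : ℕ∞) φ)
    (hlog : Integrable (fun ξ : En (d+1) => Real.log (ξ (Fin.last d))) (sig d)) :
    lap (d+1) (Gphi d φ) (eN d) = ((d:ℝ) - 1) * (∫ ξ, φ (ξ (Fin.last d)) ∂(halfM d))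
      + ∫ ξ, (deriv (deriv φ) (ξ (Fin.last d)) * (1 - ξ (Fin.last d)^2)
         - d * (deriv φ (ξ (Fin.last d)) * ξ (Fin.last d))) * Real.log (ξ (Fin.last d)) ∂(halfM d) := by
  have hcd := Gphi_contDiff hφ hlog
  have hlog' : Integrable (fun ξ : En (d+1) => Real.log (ξ (Fin.last d))) (halfM d) := hlog.restrict
  have hφ' : ContDiff ℝ (⊤ : ℕ∞) (deriv φ) := (contDiff_infty_iff_deriv.1 hφ).2
  have hφ'' : Continuous (deriv (deriv φ)) := (contDiff_infty_iff_deriv.1 hφ').2.continuous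
  set c := ∫ ξ, φ (ξ (Fin.last d)) ∂(halfM d) with hc
  -- last direction
  have hlast : iteratedFDeriv ℝ 2 (Gphi d φ) (eN d) (fun _ => stdB (d+1) (Fin.last d)) = -c := by
    refine second_dir hcd _ (F' := fun s => (1+s)⁻¹ * c) ?_ ?_
    · have hev : ∀ᶠ s in nhds (0:ℝ), 0 < 1 + s := by
        have : Filter.Tendsto (fun s : ℝ => 1 + s) (nhds 0) (nhds (1+0)) :=
          (continuous_const.add continuous_id).tendsto 0
        exact this.eventually_const_lt (by norm_num)
      have heq : ∀ s : ℝ, 0 < 1 + s → Gphi d φ (eN d + s • stdB (d+1) (Fin.last d)) =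
          Real.log (1+s) * c + ∫ ξ, φ ⟪eN d, ξ⟫ • Real.log (ξ (Fin.last d)) ∂(halfM d) := by
        intro s hs
        have e1 : eN d + s • stdB (d+1) (Fin.last d) = (1+s) • eN d := by
          rw [add_smul, one_smul]; rfl
        have e2 : ‖(1+s) • eN d‖ = 1 + s := by
          rw [norm_smul, norm_eN, mul_one, Real.norm_of_nonneg hs.le]
        rw [e1, Gphi_eq hφ hlog _ (by rw [← norm_ne_zero_iff, e2]; exact hs.ne'), e2, smul_smul,
          inv_mul_cancel₀ hs.ne', one_smul]
        simp only [inner_eN, smul_eq_mul, mul_one, hc]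
      filter_upwards [hev.eventually_nhds] with s hs
      have hs0 : 0 < 1 + s := hs.self_of_nhds
      have h1 : HasDerivAt (fun s : ℝ => 1 + s) 1 s := by simpa using (hasDerivAt_id s).const_add 1
      have h2 := ((h1.log hs0.ne').mul_const c).add_const
        (∫ ξ, φ ⟪eN d, ξ⟫ • Real.log (ξ (Fin.last d)) ∂(halfM d))
      rw [one_div] at h2
      refine h2.congr_of_eventuallyEq ?_
      filter_upwards [hs] with t ht using heq t ht
    · have h1 : HasDerivAt (fun s : ℝ => 1 + s) 1 0 := by simpa using (hasDerivAt_id (0:ℝ)).const_add 1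
      have := (h1.inv (by norm_num)).mul_const c
      refine HasDerivAt.congr_deriv this ?_
      norm_num
  -- other directions
  have hoth : ∀ i : Fin d, iteratedFDeriv ℝ 2 (Gphi d φ) (eN d) (fun _ => stdB (d+1) i.castSucc)
      = c + ∫ ξ, (deriv (deriv φ) (ξ (Fin.last d)) * (ξ i.castSucc)^2
        - deriv φ (ξ (Fin.last d)) * ξ (Fin.last d)) * Real.log (ξ (Fin.last d)) ∂(halfM d) := by
    intro i
    obtain ⟨A', a1, a2⟩ := par_curve (halfM_ae d) hφ (u := fun _ => (1:ℝ)) (integrable_const _) (eN d)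
      (stdB (d+1) i.castSucc)
    obtain ⟨B', b1, b2⟩ := par_curve (halfM_ae d) hφ (u := fun ξ => Real.log (ξ (Fin.last d))) hlog' (eN d)
      (stdB (d+1) i.castSucc)
    set A : ℝ → ℝ := fun s : ℝ => ∫ ξ, φ ⟪(Real.sqrt (1 + s^2))⁻¹ • (eN d + s • stdB (d+1) i.castSucc), ξ⟫ • (1:ℝ) ∂(halfM d) with hA
    set B : ℝ → ℝ := fun s : ℝ => ∫ ξ, φ ⟪(Real.sqrt (1 + s^2))⁻¹ • (eN d + s • stdB (d+1) i.castSucc), ξ⟫ • Real.log (ξ (Fin.last d)) ∂(halfM d) with hB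
    have hnorm : ∀ s : ℝ, ‖eN d + s • stdB (d+1) i.castSucc‖ = Real.sqrt (1+s^2) := by
      intro s
      have := norm_gam i s
      rw [norm_smul, norm_inv, Real.norm_of_nonneg (Real.sqrt_nonneg _)] at this
      have hp : 0 < Real.sqrt (1+s^2) := Real.sqrt_pos.2 (by positivity)
      field_simp at this
      exact this
    have heq : ∀ s : ℝ, Gphi d φ (eN d + s • stdB (d+1) i.castSucc) = (Real.log (1+s^2) / 2) * A s + B s := by
      intro s
      have hp : 0 < Real.sqrt (1+s^2) := Real.sqrt_pos.2 (by positivity)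
      rw [Gphi_eq hφ hlog _ (by rw [← norm_ne_zero_iff, hnorm]; exact hp.ne'), hnorm, Real.log_sqrt (by positivity)]
    have hq : ∀ s : ℝ, HasDerivAt (fun s : ℝ => 1 + s^2) (2*s) s := fun s => by
      simpa using (hasDerivAt_pow 2 s).const_add 1
    have hl : ∀ s : ℝ, HasDerivAt (fun s : ℝ => Real.log (1+s^2)/2) (s / (1+s^2)) s := fun s => by
      have := ((hq s).log (by positivity)).div_const 2
      refine HasDerivAt.congr_deriv this ?_
      field_simp
    refine second_dir hcd _ (F' := fun s => (s / (1+s^2)) * A s + (Real.log (1+s^2)/2) * A' s + B' s) ?_ ?_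
    · refine Filter.Eventually.of_forall fun s => ?_
      have := ((hl s).mul (a1 s)).add (b1 s)
      refine this.congr_of_eventuallyEq (Filter.Eventually.of_forall fun t => heq t)
    · have h0 : HasDerivAt (fun s : ℝ => s / (1+s^2)) 1 0 := by
        have := (hasDerivAt_id (0:ℝ)).div (hq 0) (by norm_num)
        refine HasDerivAt.congr_deriv this ?_
        norm_num
      have := ((h0.mul (a1 0)).add ((hl 0).mul a2)).add b2
      refine HasDerivAt.congr_deriv this ?_
      have hA0 : A 0 = c := by
        simp [hA, hc, inner_eN]
      rw [hA0]
      simp only [inner_eN, inner_std]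
      simp
  have hii : ∀ i : Fin d, Integrable (fun ξ : En (d+1) => (deriv (deriv φ) (ξ (Fin.last d)) * (ξ i.castSucc)^2
        - deriv φ (ξ (Fin.last d)) * ξ (Fin.last d)) * Real.log (ξ (Fin.last d))) (halfM d) := by
    intro i
    have hφ'c := hφ'.continuous
    have hcont : Continuous (fun ξ : En (d+1) => (deriv (deriv φ) (ξ (Fin.last d)) * (ξ i.castSucc)^2
        - deriv φ (ξ (Fin.last d)) * ξ (Fin.last d))) := by fun_prop
    obtain ⟨K, hK⟩ := (isCompact_sphere (0 : En (d+1)) 1).exists_bound_of_continuousOn hcont.continuousOn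
    refine Integrable.bdd_mul (c := K) hlog' hcont.aestronglyMeasurable ?_
    filter_upwards [halfM_ae d] with ξ hξ using hK ξ (by simpa using hξ)
  unfold lap
  rw [Fin.sum_univ_castSucc, hlast, Finset.sum_congr rfl (fun i _ => hoth i), Finset.sum_add_distrib,
    ← integral_finsetSum _ (fun i _ => hii i)]
  have hfin : (∫ ξ, ∑ i : Fin d, (deriv (deriv φ) (ξ (Fin.last d)) * (ξ i.castSucc)^2
        - deriv φ (ξ (Fin.last d)) * ξ (Fin.last d)) * Real.log (ξ (Fin.last d)) ∂(halfM d)) =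
      ∫ ξ, (deriv (deriv φ) (ξ (Fin.last d)) * (1 - ξ (Fin.last d)^2)
         - d * (deriv φ (ξ (Fin.last d)) * ξ (Fin.last d))) * Real.log (ξ (Fin.last d)) ∂(halfM d) := by
    refine integral_congr_ae ?_
    filter_upwards [halfM_ae d] with ξ hξ
    rw [← Finset.sum_mul, Finset.sum_sub_distrib, ← Finset.mul_sum, sum_sq ξ hξ]
    simp
  rw [hfin]
  simp
  ring

end


section

lemma oned (p : ℕ) {φ : ℝ → ℝ} (hφ : ContDiff ℝ (⊤ : ℕ∞) φ) (h0 : φ 0 = 1) (h0' : deriv φ 0 = 0) :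
    IntervalIntegrable (fun t => wt p t * ((φ t - 1)/t^2)) volume 0 1 ∧
    ∫ t in (0:ℝ)..1, wt p t * ((deriv (deriv φ) t * (1 - t^2) - (2*p+3:ℝ) * (deriv φ t * t)) * Real.log t)
     = - (∫ t in (0:ℝ)..1, wt p t * ((φ t - 1)/t^2)) - (2*p+2) * ∫ t in (0:ℝ)..1, wt p t * (φ t - 1) := by
  have hφ' : ContDiff ℝ (⊤ : ℕ∞) (deriv φ) := (contDiff_infty_iff_deriv.1 hφ).2
  have hφ'' : Continuous (deriv (deriv φ)) := (contDiff_infty_iff_deriv.1 hφ').2.continuous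
  have hφ'c := hφ'.continuous
  have hφc := hφ.continuous
  have hw := wt_cont p
  have hw1 := wt_cont (p+1)
  have hd : Differentiable ℝ φ := (contDiff_infty_iff_deriv.1 hφ).1
  have hd' : Differentiable ℝ (deriv φ) := (contDiff_infty_iff_deriv.1 hφ').1
  -- dslopes
  have hgc : Continuous (dslope (deriv φ) 0) := by
    rw [← continuousOn_univ]
    exact (continuousOn_dslope Filter.univ_mem).2 ⟨hφ'c.continuousOn, hd' 0⟩
  have hhc : Continuous (dslope φ 0) := by
    rw [← continuousOn_univ]
    exact (continuousOn_dslope Filter.univ_mem).2 ⟨hφc.continuousOn, hd 0⟩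
  have hg : ∀ t, deriv φ t = t * dslope (deriv φ) 0 t := by
    intro t
    have := sub_smul_dslope (deriv φ) 0 t
    simp [h0'] at this
    exact this.symm
  have hh : ∀ t, (φ t - 1) / t = dslope φ 0 t := by
    intro t
    have := sub_smul_dslope φ 0 t
    simp [h0] at this
    rcases eq_or_ne t 0 with rfl | ht
    · simp [dslope_same, h0']
    · rw [← this]; field_simp
  -- bound
  obtain ⟨M, hM⟩ := (isCompact_Icc (a := (0:ℝ)) (b := 1)).exists_bound_of_continuousOn hgc.continuousOn
  have hbd : ∀ t ∈ Set.Ioc (0:ℝ) 1, ‖(φ t - 1)/t^2‖ ≤ M := by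
    intro t ht
    have hM0 : 0 ≤ M := le_trans (norm_nonneg _) (hM 0 (by simp))
    have := (convex_Icc (0:ℝ) t).norm_image_sub_le_of_norm_deriv_le (f := φ) (C := M * t) (x := 0) (y := t)
      (fun x _ => hd x) (fun x hx => by
        rw [hg x, norm_mul, mul_comm, Real.norm_of_nonneg hx.1]
        exact mul_le_mul (hM x ⟨hx.1, hx.2.trans ht.2⟩) hx.2 hx.1 hM0)
      ⟨le_rfl, ht.1.le⟩ ⟨ht.1.le, le_rfl⟩
    rw [h0, sub_zero, Real.norm_of_nonneg ht.1.le] at this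
    have htp : 0 < t := ht.1
    rw [norm_div, norm_pow, Real.norm_of_nonneg htp.le, div_le_iff₀ (by positivity)]
    linarith
  have iR0 : IntervalIntegrable (fun t => (φ t - 1)/t^2) volume 0 1 := by
    rw [intervalIntegrable_iff_integrableOn_Ioc_of_le zero_le_one]
    refine Integrable.mono' (g := fun _ => M) (integrable_const _) ?_ ?_
    · exact Measurable.aestronglyMeasurable (by
        have := hφc.measurable
        fun_prop)
    · filter_upwards [ae_restrict_mem measurableSet_Ioc] with t ht using hbd t ht
  have iR : IntervalIntegrable (fun t => wt p t * ((φ t - 1)/t^2)) volume 0 1 :=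
    iR0.continuousOn_mul hw.continuousOn
  have iL : IntervalIntegrable (fun t => wt p t * ((deriv (deriv φ) t * (1 - t^2) - (2*p+3:ℝ) * (deriv φ t * t)) * Real.log t)) volume 0 1 := by
    have : IntervalIntegrable Real.log volume 0 1 := intervalIntegral.intervalIntegrable_log'
    have := this.continuousOn_mul (g := fun t => wt p t * (deriv (deriv φ) t * (1 - t^2) - (2*p+3:ℝ) * (deriv φ t * t))) (Continuous.continuousOn (by fun_prop))
    simpa only [mul_assoc] using this
  have iW : IntervalIntegrable (fun t => wt p t * (φ t - 1)) volume 0 1 :=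
    Continuous.intervalIntegrable (by fun_prop) _ _
  refine ⟨iR, ?_⟩
  have key := intervalIntegral.integral_eq_sub_of_hasDerivAt_of_le (a := 0) (b := 1)
    (f := fun t => (t * Real.log t) * dslope (deriv φ) 0 t * wt (p+1) t - dslope φ 0 t * wt (p+1) t)
    (f' := fun t => wt p t * ((deriv (deriv φ) t * (1 - t^2) - (2*p+3:ℝ) * (deriv φ t * t)) * Real.log t)
      + wt p t * ((φ t - 1)/t^2) + (2*p+2) * (wt p t * (φ t - 1))) zero_le_one
    (Continuous.continuousOn (by
      have := Real.continuous_mul_log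
      fun_prop)) ?_ ((iL.add iR).add (iW.const_mul _))
  · rw [intervalIntegral.integral_add (iL.add iR) (iW.const_mul _), intervalIntegral.integral_add iL iR,
      intervalIntegral.integral_const_mul] at key
    have e0 : dslope φ 0 0 = 0 := by rw [← hh]; simp
    rw [(wt_end p).1, e0] at key
    simp at key
    linarith
  · intro t ht
    have ht0 : t ≠ 0 := ht.1.ne'
    have hwd := wt_deriv p (t := t) ⟨by linarith [ht.1], ht.2⟩
    have e1 := ((Real.hasDerivAt_log ht0).mul (hd' t).hasDerivAt).mul hwd
    have e2 := (((hd t).hasDerivAt.sub_const 1).div (hasDerivAt_id t) ht0).mul hwd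
    refine ((e1.sub e2).congr_of_eventuallyEq ?_).congr_deriv ?_
    · refine Filter.Eventually.of_forall fun s => ?_
      simp only [Pi.mul_apply, Pi.sub_apply, Pi.div_apply, id]
      rw [hh, hg]; ring
    · simp only [Pi.mul_apply, Pi.div_apply, id]
      rw [wt_succ]
      field_simp
      ring

lemma lap_neg (p : ℕ) {φ : ℝ → ℝ} (hφ : ContDiff ℝ (⊤ : ℕ∞) φ) (h0 : φ 0 = 1) (h0' : deriv φ 0 = 0)
    (h1 : ∀ t ∈ Set.Icc (0:ℝ) 1, 1 ≤ φ t)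
    (hbig : (2*p+3) * ∫ t in (0:ℝ)..1, wt p t < ∫ t in (0:ℝ)..1, wt p t * φ t) :
    lap (2*p+3+1) (Gphi (2*p+3) φ) (eN (2*p+3)) < 0 := by
  obtain ⟨c, hc, h⟩ := nuM_eq p
  have hφ' : ContDiff ℝ (⊤ : ℕ∞) (deriv φ) := (contDiff_infty_iff_deriv.1 hφ).2
  have hφ'' : Continuous (deriv (deriv φ)) := (contDiff_infty_iff_deriv.1 hφ').2.continuous
  have hφ'c := hφ'.continuous
  have hφc := hφ.continuous
  have hw := wt_cont p
  rw [lap_formula hφ (log_integrable p h)]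
  unfold halfM
  rw [half_int p hc h φ hφc.measurable,
    half_int p hc h (fun t => (deriv (deriv φ) t * (1 - t^2) - (2*p+3:ℕ) * (deriv φ t * t)) * Real.log t)
      (by
        have := hφ''.measurable
        have := hφ'c.measurable
        fun_prop)]
  obtain ⟨iR, e⟩ := oned p hφ h0 h0'
  push_cast
  rw [e]
  have iW : IntervalIntegrable (wt p) volume 0 1 := hw.intervalIntegrable _ _
  have iF : IntervalIntegrable (fun t => wt p t * φ t) volume 0 1 :=
    Continuous.intervalIntegrable (by fun_prop) _ _
  have e2 : ∫ t in (0:ℝ)..1, wt p t * (φ t - 1) = (∫ t in (0:ℝ)..1, wt p t * φ t) - ∫ t in (0:ℝ)..1, wt p t := by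
    rw [← intervalIntegral.integral_sub iF iW]
    simp only [mul_sub, mul_one]
  have hle : ∫ t in (0:ℝ)..1, wt p t * (φ t - 1) ≤ ∫ t in (0:ℝ)..1, wt p t * ((φ t - 1)/t^2) := by
    refine intervalIntegral.integral_mono_on_of_le_Ioo zero_le_one
      (Continuous.intervalIntegrable (by fun_prop) _ _) iR ?_
    intro t ht
    refine mul_le_mul_of_nonneg_left ?_ (wt_nonneg p ⟨by linarith [ht.1], ht.2.le⟩)
    have := h1 t ⟨ht.1.le, ht.2.le⟩
    have htp := ht.1
    rw [le_div_iff₀ (by positivity)]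
    have : t^2 ≤ 1 := by nlinarith [ht.1, ht.2]
    nlinarith
  rw [e2] at hle ⊢
  set I := ∫ t in (0:ℝ)..1, wt p t
  set J := ∫ t in (0:ℝ)..1, wt p t * φ t
  set R := ∫ t in (0:ℝ)..1, wt p t * ((φ t - 1)/t^2)
  have : (2*p+2)*I - R < 0 := by linarith
  nlinarith
end


section

def qa (p : ℕ) (α t : ℝ) : ℝ := (1-t^2)^(p+1) - α * (1-t^2)^p * t^2 + t^(2*(p+1))

lemma x0_exists (p : ℕ) (hp : 1 ≤ p) : ∃ x : ℝ, 0 < x ∧ (p:ℝ) * x^(p+1) = 1 ∧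
    ((p+1:ℕ):ℝ) * (((p+1:ℕ):ℝ) - 1) ^ (((1:ℝ) - ((p+1:ℕ):ℝ))/((p+1:ℕ):ℝ)) = (p+1) * x^p := by
  have hp0 : (0:ℝ) < p := by exact_mod_cast hp
  refine ⟨(p:ℝ)^(-(1:ℝ)/((p+1:ℕ):ℝ)), by positivity, ?_, ?_⟩
  · rw [← Real.rpow_natCast, ← Real.rpow_mul hp0.le]
    have : (-(1:ℝ)/((p+1:ℕ):ℝ)) * ((p+1:ℕ):ℝ) = -1 := by
      have : ((p+1:ℕ):ℝ) ≠ 0 := by positivity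
      field_simp
    rw [this, Real.rpow_neg_one, mul_inv_cancel₀ hp0.ne']
  · rw [← Real.rpow_natCast, ← Real.rpow_mul hp0.le]
    push_cast
    congr 2
    · ring
    · ring

lemma bern (p : ℕ) {x a b : ℝ} (hx : 0 < x) (hx1 : (p:ℝ) * x^(p+1) = 1) (ha : 0 ≤ a) (hb : 0 ≤ b) :
    0 ≤ a^(p+1) - ((p+1) * x^p) * a^p * b + b^(p+1) := by
  rcases ha.eq_or_lt with rfl | ha
  · rcases Nat.eq_zero_or_pos p with rfl | hp
    · simp at hx1
    · simp [hp.ne']; positivity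
  · have h := one_add_mul_le_pow (a := b/(a*x) - 1) (by have : 0 ≤ b/(a*x) := by positivity
                                                        linarith) (p+1)
    have e : 1 + (b/(a*x) - 1) = b/(a*x) := by ring
    rw [e, div_pow] at h
    have hP : 0 < (a*x)^(p+1) := by positivity
    have h2 := mul_le_mul_of_nonneg_right h hP.le
    rw [div_mul_cancel₀ _ hP.ne'] at h2
    have e2 : (1 + ((p+1:ℕ):ℝ) * (b/(a*x) - 1)) * (a*x)^(p+1)
        = - a^(p+1) * ((p:ℝ) * x^(p+1)) + (p+1) * x^p * a^p * b := by
      push_cast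
      field_simp
      ring
    rw [e2, hx1] at h2
    linarith

lemma qa_nonneg (p : ℕ) {x : ℝ} (hx : 0 < x) (hx1 : (p:ℝ) * x^(p+1) = 1) {t : ℝ} (ht : t ∈ Set.Icc (-1:ℝ) 1) :
    0 ≤ qa p ((p+1) * x^p) t := by
  have := bern p hx hx1 (a := 1 - t^2) (b := t^2) (by nlinarith [ht.1, ht.2]) (by positivity)
  unfold qa
  rwa [pow_mul]

lemma qa_diff (p : ℕ) (α β t : ℝ) : qa p α t = qa p β t + (β - α) * ((1-t^2)^p * t^2) := by
  unfold qa; ring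

lemma qa_pos (p : ℕ) (hp : 1 ≤ p) {x : ℝ} (hx : 0 < x) (hx1 : (p:ℝ) * x^(p+1) = 1) {α : ℝ}
    (hα : α < (p+1) * x^p) {t : ℝ} (ht : t ∈ Set.Icc (-1:ℝ) 1) : 0 < qa p α t := by
  have ha : 0 ≤ 1 - t^2 := by nlinarith [ht.1, ht.2]
  have hb : 0 ≤ t^2 := by positivity
  rcases ha.eq_or_lt with h | h
  · unfold qa
    rw [← h, pow_mul, show t^2 = 1 by linarith]
    simp [show p ≠ 0 by omega]
  rcases hb.eq_or_lt with h' | h'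
  · unfold qa
    rw [pow_mul, ← h']
    simp
  have := qa_nonneg p hx hx1 ht
  rw [qa_diff p α ((p+1) * x^p)]
  have : 0 < ((p+1) * x^p - α) * ((1-t^2)^p * t^2) := by
    have := sub_pos.2 hα
    positivity
  linarith

lemma qa_le_one (p : ℕ) {α : ℝ} (hα : 0 ≤ α) {t : ℝ} (ht : t ∈ Set.Icc (-1:ℝ) 1) : qa p α t ≤ 1 := by
  have ha : 0 ≤ 1 - t^2 := by nlinarith [ht.1, ht.2]
  have hb : 0 ≤ t^2 := by positivity
  unfold qa
  rw [pow_mul]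
  have h1 := pow_le_of_le_one ha (by linarith) (n := p+1) (by omega)
  have h2 := pow_le_of_le_one hb (by linarith) (n := p+1) (by omega)
  have : 0 ≤ α * (1-t^2)^p * t^2 := by positivity
  linarith

lemma qa_cont (p : ℕ) (α : ℝ) : ContDiff ℝ (⊤ : ℕ∞) (qa p α) := by
  unfold qa; fun_prop

lemma qa_quad (p : ℕ) {x : ℝ} (hx : 0 < x) (hx1 : (p:ℝ) * x^(p+1) = 1) :
    ∃ t0 ∈ Set.Ioo (0:ℝ) 1, ∃ K : ℝ, 0 ≤ K ∧ ∀ t ∈ Set.Icc (0:ℝ) 1, qa p ((p+1) * x^p) t ≤ K * (t - t0)^2 := by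
  have hr : 0 < x / (1+x) := by positivity
  have hr1 : x / (1+x) < 1 := by rw [div_lt_one (by positivity)]; linarith
  set t0 := Real.sqrt (x/(1+x)) with ht0
  have hsq : t0^2 = x/(1+x) := Real.sq_sqrt hr.le
  have hpos : 0 < t0 := Real.sqrt_pos.2 hr
  have hlt : t0 < 1 := by
    rw [ht0, Real.sqrt_lt' one_pos]; simpa using hr1
  refine ⟨t0, ⟨hpos, hlt⟩, ?_⟩
  set P : Polynomial ℝ := (1 - Polynomial.X^2)^(p+1) - Polynomial.C ((p+1) * x^p) * (1-Polynomial.X^2)^p * Polynomial.X^2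
    + Polynomial.X^(2*(p+1)) with hP
  have hev : ∀ t, P.eval t = qa p ((p+1) * x^p) t := by
    intro t; simp [hP, qa]
  have hz : qa p ((p+1) * x^p) t0 = 0 := by
    unfold qa
    have e1 : 1 - t0^2 = 1/(1+x) := by rw [hsq]; field_simp; ring
    rw [pow_mul, e1, hsq]
    simp only [div_pow, one_pow]
    field_simp
    linear_combination (-(1+x)*(1+x)^p) * hx1
  have hmin : IsLocalMin (fun t => P.eval t) t0 := by
    filter_upwards [Icc_mem_nhds (by linarith : (-1:ℝ) < t0) hlt] with t ht
    rw [hev, hev, hz]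
    exact qa_nonneg p hx hx1 ht
  have hder : P.derivative.eval t0 = 0 := by
    rw [← Polynomial.deriv]; exact hmin.deriv_eq_zero
  have hne : P ≠ 0 := by
    intro h
    have h1 := hev 0
    rw [h] at h1
    simp [qa] at h1
  have hmul := (Polynomial.one_lt_rootMultiplicity_iff_isRoot hne).2 ⟨(hev t0).trans hz, hder⟩
  obtain ⟨R, hR⟩ := (Polynomial.le_rootMultiplicity_iff hne).1 (show 2 ≤ P.rootMultiplicity t0 from hmul)
  obtain ⟨K, hK⟩ := (isCompact_Icc (a := (0:ℝ)) (b := 1)).exists_bound_of_continuousOn R.continuous.continuousOn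
  refine ⟨K, le_trans (norm_nonneg _) (hK 0 (by simp)), ?_⟩
  intro t ht
  rw [← hev, hR]
  simp only [Polynomial.eval_mul, Polynomial.eval_pow, Polynomial.eval_sub, Polynomial.eval_X, Polynomial.eval_C]
  rw [mul_comm]
  exact mul_le_mul_of_nonneg_right (le_trans (le_abs_self _) (hK t ht)) (sq_nonneg _)

lemma diverge (p : ℕ) (hp : 1 ≤ p) {x : ℝ} (hx : 0 < x) (hx1 : (p:ℝ) * x^(p+1) = 1) (B : ℝ) :
    ∃ α : ℝ, 0 ≤ α ∧ α < (p+1) * x^p ∧ B < ∫ t in (0:ℝ)..1, wt p t * (qa p α t)⁻¹ := by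
  obtain ⟨t0, ⟨h0, h1⟩, K, hK0, hK⟩ := qa_quad p hx hx1
  have hw0 : 0 < wt p t0 := wt_pos p ⟨by linarith, h1⟩
  set w := wt p t0 / 2 with hw
  have hwp : 0 < w := by positivity
  have hnear : ∀ᶠ t in nhds t0, w < wt p t :=
    (wt_cont p).continuousAt.eventually_const_lt (by linarith)
  obtain ⟨ε, hε, hεw⟩ := Metric.eventually_nhds_iff.1 hnear
  set S : ℝ := (p+1) * x^p with hS
  have hSp : 0 < S := by positivity
  set δ : ℝ := min (min (ε/2) (1-t0)) (min (min 1 S) (w/((K+1)*(|B|+1)))) with hδ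
  have hδ0 : 0 < δ := by
    simp only [hδ, lt_min_iff]
    refine ⟨⟨by positivity, by linarith⟩, ⟨by norm_num, hSp⟩, by positivity⟩
  have d1 : δ ≤ ε/2 := (min_le_left _ _).trans (min_le_left _ _)
  have d2 : δ ≤ 1 - t0 := (min_le_left _ _).trans (min_le_right _ _)
  have d3 : δ ≤ 1 := (min_le_right _ _).trans ((min_le_left _ _).trans (min_le_left _ _))
  have d4 : δ ≤ S := (min_le_right _ _).trans ((min_le_left _ _).trans (min_le_right _ _))
  have d5 : δ ≤ w/((K+1)*(|B|+1)) := (min_le_right _ _).trans (min_le_right _ _)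
  have hα : S - δ^2 < S := by nlinarith
  refine ⟨S - δ^2, by nlinarith, hα, ?_⟩
  have hqp : ∀ t ∈ Set.Icc (-1:ℝ) 1, 0 < qa p (S - δ^2) t := fun t ht => qa_pos p hp hx hx1 hα ht
  have hcont : ContinuousOn (fun t => wt p t * (qa p (S - δ^2) t)⁻¹) (Set.Icc 0 1) :=
    (wt_cont p).continuousOn.mul ((qa_cont p _).continuous.continuousOn.inv₀
      fun t ht => (hqp t ⟨by linarith [ht.1], ht.2⟩).ne')
  have hint : IntervalIntegrable (fun t => wt p t * (qa p (S - δ^2) t)⁻¹) volume 0 1 :=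
    ContinuousOn.intervalIntegrable_of_Icc zero_le_one hcont
  have hle : ∫ t in t0..(t0+δ), wt p t * (qa p (S - δ^2) t)⁻¹ ≤ ∫ t in (0:ℝ)..1, wt p t * (qa p (S - δ^2) t)⁻¹ := by
    refine intervalIntegral.integral_mono_interval h0.le (by linarith) (by linarith) ?_ hint
    filter_upwards [ae_restrict_mem measurableSet_Ioc] with t ht
    have htt : t ∈ Set.Icc (-1:ℝ) 1 := ⟨by linarith [ht.1], ht.2⟩
    exact mul_nonneg (wt_nonneg p htt) (inv_nonneg.2 (hqp t htt).le)
  have hlow : ∫ t in t0..(t0+δ), w * ((K+1)*δ^2)⁻¹ ≤ ∫ t in t0..(t0+δ), wt p t * (qa p (S - δ^2) t)⁻¹ := by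
    refine intervalIntegral.integral_mono_on (by linarith) (by simp) ?_ ?_
    · exact ContinuousOn.intervalIntegrable_of_Icc (by linarith)
        (hcont.mono (Set.Icc_subset_Icc h0.le (by linarith)))
    intro t ht
    have htt : t ∈ Set.Icc (-1:ℝ) 1 := ⟨by linarith [ht.1], by linarith [ht.2]⟩
    have hwt : w ≤ wt p t := by
      refine (hεw ?_).le
      rw [Real.dist_eq, abs_of_nonneg (by linarith [ht.1])]
      linarith [ht.2]
    have hq := hqp t htt
    refine mul_le_mul hwt ?_ (by positivity) (wt_nonneg p htt)
    refine inv_anti₀ hq ?_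
    rw [qa_diff p _ S]
    have ha : 0 ≤ 1 - t^2 := by nlinarith [htt.1, htt.2]
    have ha1 : (1-t^2)^p ≤ 1 := pow_le_one₀ ha (by nlinarith [sq_nonneg t])
    have hab : (1-t^2)^p * t^2 ≤ 1 := mul_le_one₀ ha1 (by positivity) (by linarith)
    have hk := hK t ⟨by linarith [ht.1], htt.2⟩
    have hd : (t-t0)^2 ≤ δ^2 := pow_le_pow_left₀ (by linarith [ht.1]) (by linarith [ht.2]) 2
    have hk2 := mul_le_mul_of_nonneg_left hd hK0
    have : (S - (S - δ^2)) * ((1-t^2)^p * t^2) ≤ δ^2 * 1 := by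
      rw [sub_sub_cancel]; exact mul_le_mul_of_nonneg_left hab (by positivity)
    linarith
  have hval : ∫ t in t0..(t0+δ), w * ((K+1)*δ^2)⁻¹ = w / ((K+1)*δ) := by
    rw [intervalIntegral.integral_const]
    simp only [smul_eq_mul]
    field_simp
    ring
  have hfin : |B| + 1 ≤ w / ((K+1)*δ) := by
    rw [le_div_iff₀ (by positivity)] at d5 ⊢
    linarith
  have := le_abs_self B
  linarith

lemma smooth_ext {q : ℝ → ℝ} (hq : ContDiff ℝ (⊤ : ℕ∞) q) (hpos : ∀ t ∈ Set.Icc (-1:ℝ) 1, 0 < q t) :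
    ∃ φ : ℝ → ℝ, ContDiff ℝ (⊤ : ℕ∞) φ ∧ ∀ t ∈ Set.Icc (-1:ℝ) 1, φ t = (q t)⁻¹ := by
  have hcl : IsClosed {t | q t ≤ 0} := isClosed_le hq.continuous continuous_const
  obtain ⟨f, hf0, hf1, hf⟩ := exists_contMDiffMap_zero_one_of_isClosed (n := (⊤:ℕ∞)) (modelWithCornersSelf ℝ ℝ)
    hcl (isClosed_Icc (a := (-1:ℝ)) (b := 1)) (by
      rw [Set.disjoint_left]
      intro t ht ht'
      exact absurd (hpos t ht') (not_lt.2 ht))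
  have hfc : ContDiff ℝ (⊤:ℕ∞) f := f.contMDiff.contDiff
  refine ⟨fun t => (f t * q t + (1 - f t))⁻¹, ?_, ?_⟩
  · refine ContDiff.inv (by fun_prop) ?_
    intro t
    refine ne_of_gt ?_
    rcases le_or_gt (q t) 0 with h | h
    · rw [hf0 h]; simp
    · have := hf t
      rcases this.1.eq_or_lt with h' | h'
      · rw [← h']; simp
      · have := mul_pos h' h
        linarith [(hf t).2]
  · intro t ht
    simp [hf1 ht]

theorem main_thm (m : ℕ) (hm : 2 ≤ m) :
    ∃ α : ℝ, α < (m : ℝ) * ((m : ℝ) - 1) ^ (((1 : ℝ) - m)/m) ∧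
      lap (2*m+1+1) (Galpha m α)
        (EuclideanSpace.single (Fin.last (2*m+1)) (1 : ℝ)) < 0 := by
  obtain ⟨p, rfl⟩ : ∃ p, m = p+1 := ⟨m-1, by omega⟩
  have hp : 1 ≤ p := by omega
  obtain ⟨x, hx, hx1, hxa⟩ := x0_exists p hp
  rw [hxa]
  obtain ⟨α, hα0, hα, hB⟩ := diverge p hp hx hx1 ((2*p+3) * ∫ t in (0:ℝ)..1, wt p t)
  refine ⟨α, hα, ?_⟩
  have hq := fun t ht => qa_pos p hp hx hx1 hα (t := t) ht
  obtain ⟨φ, hφ, hφq⟩ := smooth_ext (qa_cont p α) hq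
  have h1 : ∀ t ∈ Set.Icc (-1:ℝ) 1, 1 ≤ φ t := fun t ht => by
    rw [hφq t ht]
    exact (one_le_inv₀ (hq t ht)).2 (qa_le_one p hα0 ht)
  have h0 : φ 0 = 1 := by
    rw [hφq 0 (by simp)]; simp [qa]
  have h0' : deriv φ 0 = 0 := by
    apply IsLocalMin.deriv_eq_zero
    filter_upwards [Icc_mem_nhds (by norm_num : (-1:ℝ) < 0) one_pos] with t ht
    rw [h0]; exact h1 t ht
  have hbig : (2*p+3) * ∫ t in (0:ℝ)..1, wt p t < ∫ t in (0:ℝ)..1, wt p t * φ t := by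
    refine hB.trans_eq (intervalIntegral.integral_congr fun t ht => ?_)
    rw [Set.uIcc_of_le zero_le_one] at ht
    change wt p t * (qa p α t)⁻¹ = wt p t * φ t
    rw [hφq t ⟨by linarith [ht.1], ht.2⟩]
  have hfin := lap_neg p hφ h0 h0' (fun t ht => h1 t ⟨by linarith [ht.1], ht.2⟩) hbig
  have hG : Galpha (p+1) α = Gphi (2*p+3) φ := by
    funext y
    unfold Galpha Gphi
    have hdim : ((2*(p+1)+1+1 : ℕ) : ℝ) - 1 = ((2*p+3:ℕ):ℝ) := by push_cast; ring
    rw [hdim]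
    refine setIntegral_congr_fun ?_ ?_
    · refine MeasurableSet.inter (s₁ := {ξ | ‖ξ‖ = 1}) (s₂ := {ξ | 0 < ⟪y, ξ⟫}) ?_ ?_
      · exact (isClosed_eq continuous_norm continuous_const).measurableSet
      · exact (isOpen_lt continuous_const (by fun_prop)).measurableSet
    · intro ξ hξ
      have hs := sum_sq (d := 2*(p+1)+1) ξ hξ.1
      have hmem : ξ (Fin.last (2*(p+1)+1)) ∈ Set.Icc (-1:ℝ) 1 := by
        have hn : 0 ≤ normSq' (2*(p+1)+1) ξ := Finset.sum_nonneg fun i _ => sq_nonneg _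
        rw [normSq', hs] at hn
        exact abs_le.1 (by rw [← sq_le_one_iff_abs_le_one]; linarith)
      have hQ : Qalpha (2*(p+1)+1) (p+1) α ξ = qa p α (ξ (Fin.last (2*(p+1)+1))) := by
        unfold Qalpha qa normSq'
        rw [hs]; rfl
      have := hφq _ hmem
      change Real.log ⟪y, ξ⟫ / Qalpha (2*(p+1)+1) (p+1) α ξ = Real.log ⟪y, ξ⟫ * φ (ξ (Fin.last (2*(p+1)+1)))
      rw [hQ, this, div_eq_mul_inv]
  rw [hG]
  exact hfin
end


/-- For every m ≥ 2 (and n = 2m+2) there is α < α*_m = m(m−1)^{(1−m)/m}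
with ΔG_α(e_n) < 0. -/
theorem stmt14 (m : ℕ) (hm : 2 ≤ m) :
    ∃ α : ℝ, α < (m : ℝ) * ((m : ℝ) - 1) ^ (((1 : ℝ) - m)/m) ∧
      lap (2*m+1+1) (Galpha m α)
        (EuclideanSpace.single (Fin.last (2*m+1)) (1 : ℝ)) < 0 := by
  exact main_thm m hm
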